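/- There is no distance-regular graph with intersection array {56, 36, 9; 1, 3, 48}. -/

import Mathlib

open SimpleGraph Finset

/-- `G` is distance-regular with intersection numbers `b i`, `c i`. -/
def IsDRG {V : Type*} [Fintype V] [DecidableEq V] (G : SimpleGraph V)
    [DecidableRel G.Adj] (b c : ℕ → ℕ) : Prop :=
  G.Connected ∧
  ∀ x y : V,
    ((G.neighborFinset y).filter (fun z => G.dist x z = G.dist x y - 1)).card
        = c (G.dist x y) ∧
    ((G.neighborFinset y).filter (fun z => G.dist x z = G.dist x y + 1)).card
        = b (G.dist x y)

section Lines

variable {V : Type*} [Fintype V] (G : SimpleGraph V)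

/-- The maximal cliques with at least `m` vertices. -/
noncomputable def lines (m : ℕ) : Finset (Finset V) :=
  open scoped Classical in
  univ.filter fun s => Maximal (fun t : Finset V => G.IsClique t) s ∧ m ≤ #s

variable {G} {k a c m : ℕ}

theorem mem_lines {s : Finset V} :
    s ∈ lines G m ↔ Maximal (fun t : Finset V => G.IsClique t) s ∧ m ≤ #s := by
  simp [lines]

theorem exists_mem_lines {s : Finset V} (hs : G.IsClique s) (hm : m ≤ #s) :
    ∃ l ∈ lines G m, s ⊆ l := by
  obtain ⟨l, hsl, hl⟩ := Finite.exists_le_maximal (p := fun t : Finset V => G.IsClique t) hs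
  exact ⟨l, mem_lines.2 ⟨hl, hm.trans (card_le_card hsl)⟩, hsl⟩

theorem adj_of_mem_lines {l : Finset V} (hl : l ∈ lines G m) {x y : V} (hx : x ∈ l) (hy : y ∈ l)
    (h : x ≠ y) : G.Adj x y :=
  (mem_lines.1 hl).1.1 hx hy h

variable [DecidableEq V] [DecidableRel G.Adj]

/-- The closed neighbourhood of `y` inside the neighbourhood of `x`. -/
def closedLocal (G : SimpleGraph V) [DecidableRel G.Adj] (x y : V) : Finset V :=
  insert y (G.neighborFinset x ∩ G.neighborFinset y)

theorem closedLocal_subset {x y : V} (h : G.Adj x y) :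
    closedLocal G x y ⊆ G.neighborFinset x := by
  intro z hz
  simp only [closedLocal, mem_insert, mem_inter, mem_neighborFinset] at hz ⊢
  rcases hz with rfl | hz
  exacts [h, hz.1]

theorem mem_closedLocal {x y z : V} (h : G.Adj x z) :
    z ∈ closedLocal G x y ↔ z = y ∨ G.Adj y z := by
  simp [closedLocal, h]

theorem card_closedLocal
    (hadj : ∀ x y, G.Adj x y → #(G.neighborFinset x ∩ G.neighborFinset y) = a)
    {x y : V} (h : G.Adj x y) : #(closedLocal G x y) = a + 1 := by
  rw [closedLocal, card_insert_of_notMem (by simp), hadj x y h]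

theorem card_closedLocal_inter_le
    (hnon : ∀ x y, x ≠ y → ¬ G.Adj x y → #(G.neighborFinset x ∩ G.neighborFinset y) ≤ c)
    {x y z : V} (hy : G.Adj x y) (hz : G.Adj x z) (hne : y ≠ z) (hyz : ¬ G.Adj y z) :
    #(closedLocal G x y ∩ closedLocal G x z) ≤ c - 1 := by
  have hx : x ∈ G.neighborFinset y ∩ G.neighborFinset z := by simp [hy.symm, hz.symm]
  have hsub : closedLocal G x y ∩ closedLocal G x z ⊆
      (G.neighborFinset y ∩ G.neighborFinset z).erase x := by
    intro w hw
    rw [mem_inter] at hw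
    have hxw : G.Adj x w := by simpa using closedLocal_subset hy hw.1
    rw [mem_closedLocal hxw, mem_closedLocal hxw] at hw
    simp only [mem_erase, mem_inter, mem_neighborFinset]
    refine ⟨hxw.ne', ?_⟩
    rcases hw with ⟨rfl | h1, rfl | h2⟩
    · exact absurd rfl hne
    · exact absurd h2.symm hyz
    · exact absurd h1 hyz
    · exact ⟨h1, h2⟩
  have := card_le_card hsub
  rw [card_erase_of_mem hx] at this
  have := hnon y z hne hyz
  omega

/-- A vertex has no four pairwise nonadjacent neighbours when `4 (a + 1) - 6 (c - 1) > k`. -/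
theorem not_four_claw (hk : ∀ x, #(G.neighborFinset x) = k)
    (hadj : ∀ x y, G.Adj x y → #(G.neighborFinset x ∩ G.neighborFinset y) = a)
    (hnon : ∀ x y, x ≠ y → ¬ G.Adj x y → #(G.neighborFinset x ∩ G.neighborFinset y) ≤ c)
    (hclaw : k + 6 * (c - 1) < 4 * (a + 1))
    {x y z u v : V} (hy : G.Adj x y) (hz : G.Adj x z) (hu : G.Adj x u) (hv : G.Adj x v)
    (hyz : y ≠ z ∧ ¬ G.Adj y z) (hyu : y ≠ u ∧ ¬ G.Adj y u) (hyv : y ≠ v ∧ ¬ G.Adj y v)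
    (hzu : z ≠ u ∧ ¬ G.Adj z u) (hzv : z ≠ v ∧ ¬ G.Adj z v) (huv : u ≠ v ∧ ¬ G.Adj u v) :
    False := by
  have h12 := card_closedLocal_inter_le hnon hy hz hyz.1 hyz.2
  have h13 := card_closedLocal_inter_le hnon hy hu hyu.1 hyu.2
  have h14 := card_closedLocal_inter_le hnon hy hv hyv.1 hyv.2
  have h23 := card_closedLocal_inter_le hnon hz hu hzu.1 hzu.2
  have h24 := card_closedLocal_inter_le hnon hz hv hzv.1 hzv.2
  have h34 := card_closedLocal_inter_le hnon hu hv huv.1 huv.2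
  have e1 := card_closedLocal hadj hy
  have e2 := card_closedLocal hadj hz
  have e3 := card_closedLocal hadj hu
  have e4 := card_closedLocal hadj hv
  have s1 := closedLocal_subset hy
  have s2 := closedLocal_subset hz
  have s3 := closedLocal_subset hu
  have s4 := closedLocal_subset hv
  have hN := hk x
  generalize closedLocal G x y = A at *
  generalize closedLocal G x z = B at *
  generalize closedLocal G x u = C at *
  generalize closedLocal G x v = D at *
  have i1 := card_union_add_card_inter A B
  have i2 := card_union_add_card_inter (A ∪ B) C
  have i3 := card_union_add_card_inter (A ∪ B ∪ C) D
  rw [union_inter_distrib_right] at i2 i3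
  rw [union_inter_distrib_right] at i3
  have j2 := card_union_le (A ∩ C) (B ∩ C)
  have j3 := card_union_le (A ∩ D ∪ B ∩ D) (C ∩ D)
  have j4 := card_union_le (A ∩ D) (B ∩ D)
  have := card_le_card (union_subset (union_subset (union_subset s1 s2) s3) s4)
  omega

theorem exists_large_clique (hk : ∀ x, #(G.neighborFinset x) = k)
    (hadj : ∀ x y, G.Adj x y → #(G.neighborFinset x ∩ G.neighborFinset y) = a)
    (hnon : ∀ x y, x ≠ y → ¬ G.Adj x y → #(G.neighborFinset x ∩ G.neighborFinset y) ≤ c)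
    (hclaw : k + 6 * (c - 1) < 4 * (a + 1)) (hka : 2 * (a + 1) < k)
    (hm : m + 2 * (c - 1) ≤ a + 2) {x y : V} (hy : G.Adj x y) :
    ∃ s : Finset V, G.IsClique s ∧ m ≤ #s ∧ x ∈ s ∧ y ∈ s := by
  have e1 := card_closedLocal hadj hy
  obtain ⟨z, hz, hz1⟩ := exists_mem_notMem_of_card_lt_card
    (s := closedLocal G x y) (t := G.neighborFinset x) (by rw [e1, hk]; omega)
  rw [mem_neighborFinset] at hz
  have e2 := card_closedLocal hadj hz
  obtain ⟨u, hu, hu1⟩ := exists_mem_notMem_of_card_lt_card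
    (s := closedLocal G x y ∪ closedLocal G x z) (t := G.neighborFinset x) (by
      have := card_union_le (closedLocal G x y) (closedLocal G x z)
      rw [hk]; omega)
  rw [mem_neighborFinset] at hu
  rw [mem_union, mem_closedLocal hu, mem_closedLocal hu] at hu1
  rw [mem_closedLocal hz] at hz1
  push Not at hz1 hu1
  obtain ⟨⟨huy, hyu⟩, huz, hzu⟩ := hu1
  have h12 := card_closedLocal_inter_le hnon hy hz hz1.1.symm hz1.2
  have h13 := card_closedLocal_inter_le hnon hy hu huy.symm hyu
  set E := closedLocal G x y \ (closedLocal G x z ∪ closedLocal G x u) with hE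
  have hEmem : ∀ w ∈ E, G.Adj x w ∧ (z ≠ w ∧ ¬ G.Adj z w) ∧ (u ≠ w ∧ ¬ G.Adj u w) := by
    intro w hw
    rw [hE, mem_sdiff, mem_union] at hw
    have hxw : G.Adj x w := by simpa using closedLocal_subset hy hw.1
    rw [mem_closedLocal hxw, mem_closedLocal hxw, mem_closedLocal hxw] at hw
    push Not at hw
    obtain ⟨hw1, ⟨hwz, hzw⟩, hwu, huw⟩ := hw
    exact ⟨hxw, ⟨hwz.symm, hzw⟩, hwu.symm, huw⟩
  refine ⟨insert x E, ?_, ?_, mem_insert_self _ _, mem_insert_of_mem ?_⟩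
  · rw [coe_insert]
    refine IsClique.insert ?_ fun w hw _ => (hEmem w hw).1
    intro p hp q hq hpq
    by_contra hn
    obtain ⟨p1, p2, p3⟩ := hEmem p hp
    obtain ⟨q1, q2, q3⟩ := hEmem q hq
    exact not_four_claw hk hadj hnon hclaw hz hu p1 q1 ⟨huz.symm, hzu⟩ p2 q2 p3 q3 ⟨hpq, hn⟩
  · rw [card_insert_of_notMem fun h => (hEmem x h).1.ne rfl]
    have i1 := card_sdiff_add_card_inter (closedLocal G x y) (closedLocal G x z ∪ closedLocal G x u)
    rw [← hE, inter_union_distrib_left] at i1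
    have i2 := card_union_le (closedLocal G x y ∩ closedLocal G x z)
      (closedLocal G x y ∩ closedLocal G x u)
    omega
  · rw [hE, mem_sdiff, mem_union, mem_closedLocal hy, mem_closedLocal hy, mem_closedLocal hy]
    push Not
    exact ⟨Or.inl rfl, ⟨hz1.1.symm, fun h => hz1.2 h.symm⟩, huy.symm, fun h => hyu h.symm⟩

theorem erase_erase_subset {l : Finset V} (hl : l ∈ lines G m) {x y : V} (hx : x ∈ l)
    (hy : y ∈ l) : (l.erase x).erase y ⊆ G.neighborFinset x ∩ G.neighborFinset y := by
  intro z hz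
  simp only [mem_erase] at hz
  simp only [mem_inter, mem_neighborFinset]
  exact ⟨adj_of_mem_lines hl hx hz.2.2 hz.2.1.symm, adj_of_mem_lines hl hy hz.2.2 hz.1.symm⟩

theorem eq_of_mem_lines
    (hadj : ∀ x y, G.Adj x y → #(G.neighborFinset x ∩ G.neighborFinset y) = a)
    (hnon : ∀ x y, x ≠ y → ¬ G.Adj x y → #(G.neighborFinset x ∩ G.neighborFinset y) ≤ c)
    (hm : a + 2 + c < 2 * m) {s t : Finset V} (hs : s ∈ lines G m) (ht : t ∈ lines G m)
    {x y : V} (hxy : x ≠ y) (hxs : x ∈ s) (hys : y ∈ s) (hxt : x ∈ t) (hyt : y ∈ t) : s = t := by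
  by_contra hne
  obtain ⟨u, hus, hut⟩ : ∃ u ∈ s, u ∉ t := by
    by_contra! h
    exact hne ((mem_lines.1 hs).1.eq_of_le (mem_lines.1 ht).1.1 h)
  obtain ⟨v, hvt, huv, hn⟩ : ∃ v ∈ t, u ≠ v ∧ ¬ G.Adj u v := by
    by_contra! h
    have hc : G.IsClique (insert u t : Finset V) := by
      rw [coe_insert]
      exact (mem_lines.1 ht).1.1.insert h
    exact hut ((mem_lines.1 ht).1.le_of_ge hc (subset_insert u t) (mem_insert_self u t))
  have h1 : s ∩ t ⊆ G.neighborFinset u ∩ G.neighborFinset v := by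
    intro w hw
    rw [mem_inter] at hw
    simp only [mem_inter, mem_neighborFinset]
    refine ⟨adj_of_mem_lines hs hus hw.1 fun h => hut (h ▸ hw.2),
      adj_of_mem_lines ht hvt hw.2 fun h => hn (adj_of_mem_lines hs hus (h ▸ hw.1) huv)⟩
  have h2 : ((s ∪ t).erase x).erase y ⊆ G.neighborFinset x ∩ G.neighborFinset y := by
    rw [erase_union_distrib, erase_union_distrib]
    exact union_subset (erase_erase_subset hs hxs hys) (erase_erase_subset ht hxt hyt)
  have c1 := (card_le_card h1).trans (hnon u v huv hn)
  have c2 := card_le_card h2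
  rw [hadj x y (adj_of_mem_lines hs hxs hys hxy),
    card_erase_of_mem (mem_erase.2 ⟨hxy.symm, mem_union_left _ hys⟩),
    card_erase_of_mem (mem_union_left _ hxs)] at c2
  have c3 := card_union_add_card_inter s t
  have c4 := (mem_lines.1 hs).2
  have c5 := (mem_lines.1 ht).2
  omega

theorem card_le_of_mem_lines
    (hadj : ∀ x y, G.Adj x y → #(G.neighborFinset x ∩ G.neighborFinset y) = a)
    {l : Finset V} (hl : l ∈ lines G m) : #l ≤ a + 2 := by
  by_contra! h
  obtain ⟨x, hx, y, hy, hxy⟩ := one_lt_card.1 (show 1 < #l by omega)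
  have := card_le_card (erase_erase_subset hl hx hy)
  rw [hadj x y (adj_of_mem_lines hl hx hy hxy), card_erase_of_mem (mem_erase.2 ⟨hxy.symm, hy⟩),
    card_erase_of_mem hx] at this
  omega

theorem neighborFinset_eq_biUnion_lines
    (hex : ∀ x y, G.Adj x y → ∃ l ∈ lines G m, x ∈ l ∧ y ∈ l) (x : V) :
    G.neighborFinset x = ((lines G m).filter (x ∈ ·)).biUnion (·.erase x) := by
  ext y
  simp only [mem_neighborFinset, mem_biUnion, mem_filter, mem_erase]
  constructor
  · intro h
    obtain ⟨l, hl, hx, hy⟩ := hex x y h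
    exact ⟨l, ⟨hl, hx⟩, h.ne', hy⟩
  · rintro ⟨l, ⟨hl, hx⟩, hne, hy⟩
    exact adj_of_mem_lines hl hx hy hne.symm

theorem sum_lines_eq
    (hex : ∀ x y, G.Adj x y → ∃ l ∈ lines G m, x ∈ l ∧ y ∈ l)
    (huniq : ∀ s ∈ lines G m, ∀ t ∈ lines G m, ∀ x y, x ≠ y → x ∈ s → y ∈ s → x ∈ t → y ∈ t →
      s = t) {M : Type*} [AddCommMonoid M] (f : V → M) (x : V) :
    ∑ y ∈ G.neighborFinset x, f y =
      ∑ l ∈ (lines G m).filter (x ∈ ·), ∑ y ∈ l.erase x, f y := by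
  rw [neighborFinset_eq_biUnion_lines hex, sum_biUnion]
  intro s hs t ht hst
  simp only [coe_filter, Set.mem_ofPred_eq] at hs ht
  refine disjoint_left.2 fun y hys hyt => hst ?_
  rw [mem_erase] at hys hyt
  exact huniq s hs.1 t ht.1 x y hys.1.symm hs.2 hys.2 ht.2 hyt.2

theorem exists_neighbor_sum_eq_neg_mul [Nonempty V] {r : ℕ} (hrm : r < m)
    (hex : ∀ x y, G.Adj x y → ∃ l ∈ lines G m, x ∈ l ∧ y ∈ l)
    (huniq : ∀ s ∈ lines G m, ∀ t ∈ lines G m, ∀ x y, x ≠ y → x ∈ s → y ∈ s → x ∈ t → y ∈ t →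
      s = t)
    (hr : ∀ x, #((lines G m).filter (x ∈ ·)) = r) :
    ∃ f : V → ℚ, f ≠ 0 ∧ ∀ x, ∑ y ∈ G.neighborFinset x, f y = -r * f x := by
  have hcard : #(lines G m) < Fintype.card V := by
    have h1 : ∑ l ∈ lines G m, #l = Fintype.card V * r := by
      have h := sum_card_bipartiteAbove_eq_sum_card_bipartiteBelow
        (s := (univ : Finset V)) (t := lines G m) (fun x l => x ∈ l)
      simp only [bipartiteAbove, bipartiteBelow, hr, filter_univ_mem] at h
      simpa using h.symm
    have h2 : #(lines G m) * m ≤ ∑ l ∈ lines G m, #l := by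
      rw [← smul_eq_mul]
      exact card_nsmul_le_sum _ _ _ fun l hl => (mem_lines.1 hl).2
    have h3 : 0 < Fintype.card V := Fintype.card_pos
    rw [h1] at h2
    by_contra! h
    nlinarith
  let T : (V → ℚ) →ₗ[ℚ] (lines G m → ℚ) :=
    LinearMap.pi fun l => ∑ y ∈ l.1, LinearMap.proj y
  obtain ⟨f, hf, hf0⟩ := T.ker.ne_bot_iff.1 (T.ker_ne_bot_of_finrank_lt (by simpa using hcard))
  refine ⟨f, hf0, fun x => ?_⟩
  have hT : ∀ l ∈ lines G m, ∑ y ∈ l, f y = 0 := by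
    intro l hl
    simpa [T] using congrFun (LinearMap.mem_ker.1 hf) ⟨l, hl⟩
  rw [sum_lines_eq hex huniq, sum_congr rfl (g := fun _ => -f x), sum_const, hr, nsmul_eq_mul]
  · ring
  · intro l hl
    rw [mem_filter] at hl
    have := add_sum_erase l f hl.2
    rw [hT l hl.1] at this
    linarith

end Lines

section Distance

variable {V : Type*} {G : SimpleGraph V}

theorem dist_cases (hG : G.Connected) {x y z : V} (h : G.Adj y z) :
    G.dist x z + 1 = G.dist x y ∨ G.dist x z = G.dist x y ∨ G.dist x z = G.dist x y + 1 := by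
  have h1 := hG.dist_triangle (u := x) (v := y) (w := z)
  have h2 := hG.dist_triangle (u := x) (v := z) (w := y)
  rw [dist_eq_one_iff_adj.2 h] at h1
  rw [dist_eq_one_iff_adj.2 h.symm] at h2
  omega

variable [Fintype V] [DecidableRel G.Adj]

/-- The number of neighbours of `y` at distance `i` from `x`. -/
noncomputable def distCount (G : SimpleGraph V) [DecidableRel G.Adj] (x y : V) (i : ℕ) : ℕ :=
  #((G.neighborFinset y).filter (fun z => G.dist x z = i))

theorem distCount_eq_zero (hG : G.Connected) {x y : V} {i : ℕ}
    (h : i + 1 < G.dist x y ∨ G.dist x y + 1 < i) : distCount G x y i = 0 := by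
  rw [distCount, card_eq_zero, filter_eq_empty_iff]
  intro z hz
  rw [mem_neighborFinset] at hz
  have := dist_cases hG (x := x) hz
  omega

theorem sum_distCount {N : ℕ} (hN : ∀ x y, G.dist x y < N) (x y : V) :
    ∑ i ∈ range N, distCount G x y i = #(G.neighborFinset y) :=
  (card_eq_sum_card_fiberwise fun z _ => by simpa using hN x z).symm

theorem sum_dist_of_neighbor_sum {f : V → ℚ} {θ : ℚ}
    (hf : ∀ x, ∑ y ∈ G.neighborFinset x, f y = θ * f x) (x : V) (i : ℕ) :
    θ * ∑ y with G.dist x y = i, f y = ∑ z, distCount G x z i * f z := by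
  simp only [mul_sum, ← hf, distCount, ← nsmul_eq_mul, ← sum_const]
  refine sum_comm' fun y z => ?_
  simp [adj_comm, and_comm]

theorem card_inter_neighborFinset [DecidableEq V] (x y : V) :
    #(G.neighborFinset x ∩ G.neighborFinset y) = distCount G x y 1 := by
  rw [distCount]
  congr 1
  ext z
  simp [dist_eq_one_iff_adj, and_comm]

end Distance

/-- There is no distance-regular graph with intersection array
`{56, 36, 9; 1, 3, 48}` (diameter `3`). -/
theorem no_drg_56_36_9 {V : Type*} [Fintype V] [DecidableEq V]
    (G : SimpleGraph V) [DecidableRel G.Adj] :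
    ¬ (IsDRG G
        (fun i => if i = 0 then 56 else if i = 1 then 36 else if i = 2 then 9 else 0)
        (fun i => if i = 1 then 1 else if i = 2 then 3 else if i = 3 then 48 else 0) ∧
      (∀ x y : V, G.dist x y ≤ 3) ∧ (∃ x y : V, G.dist x y = 3)) := by
  rintro ⟨⟨hG, hbc⟩, hd, -⟩
  have hk : ∀ x, #(G.neighborFinset x) = 56 := by
    intro x
    have h := (hbc x x).2
    simp only [dist_self, zero_add, if_true] at h
    rw [← h]
    congr 1
    ext z
    simp [dist_eq_one_iff_adj]
  have htab : ∀ x y,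
      (G.dist x y = 0 → distCount G x y 0 = 0 ∧ distCount G x y 1 = 56 ∧
        distCount G x y 2 = 0 ∧ distCount G x y 3 = 0) ∧
      (G.dist x y = 1 → distCount G x y 0 = 1 ∧ distCount G x y 1 = 19 ∧
        distCount G x y 2 = 36 ∧ distCount G x y 3 = 0) ∧
      (G.dist x y = 2 → distCount G x y 0 = 0 ∧ distCount G x y 1 = 3 ∧
        distCount G x y 2 = 44 ∧ distCount G x y 3 = 9) ∧
      (G.dist x y = 3 → distCount G x y 0 = 0 ∧ distCount G x y 1 = 0 ∧
        distCount G x y 2 = 48 ∧ distCount G x y 3 = 8) := by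
    intro x y
    have hs := sum_distCount (N := 4) (fun x y => Nat.lt_succ_of_le (hd x y)) x y
    simp only [sum_range_succ, sum_range_zero, hk] at hs
    have hz := fun i => distCount_eq_zero hG (x := x) (y := y) (i := i)
    have h0 := hz 0
    have h1 := hz 1
    have h2 := hz 2
    have h3 := hz 3
    have hb := (hbc x y).2
    have hc := (hbc x y).1
    change distCount G x y _ = _ at hb hc
    refine ⟨?_, ?_, ?_, ?_⟩ <;> intro h <;> simp [h] at h0 h1 h2 h3 hb hc <;> omega
  have hadj : ∀ x y, G.Adj x y → #(G.neighborFinset x ∩ G.neighborFinset y) = 19 := by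
    intro x y h
    rw [card_inter_neighborFinset]
    exact ((htab x y).2.1 (dist_eq_one_iff_adj.2 h)).2.1
  have hnon : ∀ x y, x ≠ y → ¬ G.Adj x y → #(G.neighborFinset x ∩ G.neighborFinset y) ≤ 3 := by
    intro x y hne h
    rw [card_inter_neighborFinset]
    have h0 := hG.pos_dist_of_ne hne
    have h1 := mt dist_eq_one_iff_adj.1 h
    have h3 := hd x y
    have := htab x y
    omega
  have hex : ∀ x y, G.Adj x y → ∃ l ∈ lines G 17, x ∈ l ∧ y ∈ l := by
    intro x y h
    obtain ⟨s, hs, hm, hx, hy⟩ := exists_large_clique (m := 17) hk hadj hnon (by norm_num)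
      (by norm_num) (by norm_num) h
    obtain ⟨l, hl, hsl⟩ := exists_mem_lines hs hm
    exact ⟨l, hl, hsl hx, hsl hy⟩
  have huniq : ∀ s ∈ lines G 17, ∀ t ∈ lines G 17, ∀ x y, x ≠ y → x ∈ s → y ∈ s → x ∈ t → y ∈ t →
      s = t := fun s hs t ht x y hxy => eq_of_mem_lines hadj hnon (by norm_num) hs ht hxy
  have hr : ∀ x, #((lines G 17).filter (x ∈ ·)) = 3 := by
    intro x
    have h := sum_lines_eq hex huniq (fun _ => 1) x
    simp only [← card_eq_sum_ones, hk] at h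
    have hl : ∀ l ∈ (lines G 17).filter (x ∈ ·), 16 ≤ #(l.erase x) ∧ #(l.erase x) ≤ 20 := by
      intro l hl
      rw [mem_filter] at hl
      rw [card_erase_of_mem hl.2]
      have := card_le_of_mem_lines hadj hl.1
      have := (mem_lines.1 hl.1).2
      omega
    have h1 := card_nsmul_le_sum _ _ _ fun l h => (hl l h).1
    have h2 := sum_le_card_nsmul _ _ _ fun l h => (hl l h).2
    rw [smul_eq_mul, ← h] at h1 h2
    omega
  have := hG.nonempty
  obtain ⟨f, hf0, hf⟩ := exists_neighbor_sum_eq_neg_mul (by norm_num) hex huniq hr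
  refine hf0 (funext fun x => ?_)
  have hsum : ∀ i, ∑ z, (distCount G x z i : ℚ) * f z =
      ∑ j ∈ range 4, ∑ z with G.dist x z = j, (distCount G x z i : ℚ) * f z := fun i =>
    (sum_fiberwise_of_maps_to (fun z _ => by simpa using Nat.lt_succ_of_le (hd x z)) _).symm
  have hconst : ∀ i j (q : ℕ), (∀ z, G.dist x z = j → distCount G x z i = q) →
      ∑ z with G.dist x z = j, (distCount G x z i : ℚ) * f z =
        q * ∑ z with G.dist x z = j, f z := by
    intro i j q h
    rw [mul_sum]
    refine sum_congr rfl fun z hz => ?_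
    rw [h z (by simpa using hz)]
  have e := fun i => (sum_dist_of_neighbor_sum hf x i).trans (hsum i)
  have e0 := e 0
  have e1 := e 1
  have e2 := e 2
  have e3 := e 3
  simp only [sum_range_succ, sum_range_zero] at e0 e1 e2 e3
  rw [hconst 0 0 0 fun z h => ((htab x z).1 h).1,
    hconst 0 1 1 fun z h => ((htab x z).2.1 h).1,
    hconst 0 2 0 fun z h => ((htab x z).2.2.1 h).1,
    hconst 0 3 0 fun z h => ((htab x z).2.2.2 h).1] at e0
  rw [hconst 1 0 56 fun z h => ((htab x z).1 h).2.1,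
    hconst 1 1 19 fun z h => ((htab x z).2.1 h).2.1,
    hconst 1 2 3 fun z h => ((htab x z).2.2.1 h).2.1,
    hconst 1 3 0 fun z h => ((htab x z).2.2.2 h).2.1] at e1
  rw [hconst 2 0 0 fun z h => ((htab x z).1 h).2.2.1,
    hconst 2 1 36 fun z h => ((htab x z).2.1 h).2.2.1,
    hconst 2 2 44 fun z h => ((htab x z).2.2.1 h).2.2.1,
    hconst 2 3 48 fun z h => ((htab x z).2.2.2 h).2.2.1] at e2
  rw [hconst 3 0 0 fun z h => ((htab x z).1 h).2.2.2,
    hconst 3 1 0 fun z h => ((htab x z).2.1 h).2.2.2,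
    hconst 3 2 9 fun z h => ((htab x z).2.2.1 h).2.2.2,
    hconst 3 3 8 fun z h => ((htab x z).2.2.2 h).2.2.2] at e3
  have hx : ∑ z with G.dist x z = 0, f z = f x := by
    simp [hG.dist_eq_zero_iff, filter_eq]
  rw [hx] at e0 e1 e2 e3
  push_cast at e0 e1 e2 e3
  simp only [Pi.zero_apply]
  linarith
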